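/- Let n ≥ 2, 1 < p < ∞, let Ω and Ω̃ be bounded open sets in ℝⁿ with the closure of Ω compactly contained in Ω̃, and let g : ℝⁿ → [0, ∞) be measurable with g = 0 a.e. outside Ω. Then the following are equivalent: (1) there exists λ > 0 such that ∫_Ω g |φ|^p dx ≤ λ ∫_{ℝⁿ} (|∇φ|^p + |φ|^p) dx for all φ ∈ C_c^∞(ℝⁿ); (2) there exists λ' > 0 such that ∫_Ω g |φ|^p dx ≤ λ' ∫_{Ω̃} |∇φ|^p dx for all φ ∈ C_c^∞(Ω̃). -/

import Mathlib

open MeasureTheory Filter Real Metric Bornology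
open scoped ENNReal RealInnerProductSpace Topology

noncomputable section

abbrev Euc (n : ℕ) := EuclideanSpace ℝ (Fin n)

/-- `φ` is a test function: smooth, compactly supported, with support contained in `U`. -/
def IsTest (n : ℕ) (U : Set (Euc n)) (φ : Euc n → ℝ) : Prop :=
  ContDiff ℝ (⊤ : ℕ∞) φ ∧ HasCompactSupport φ ∧ tsupport φ ⊆ U

/-- `V` is the weak gradient of `u` on the open set `U`
    (stated against all directions `y`, equivalently componentwise). -/
def IsWeakGrad (n : ℕ) (U : Set (Euc n)) (u : Euc n → ℝ) (V : Euc n → Euc n) : Prop :=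
  ∀ φ : Euc n → ℝ, IsTest n U φ → ∀ y : Euc n,
    ∫ x in U, u x * ⟪gradient φ x, y⟫ = - ∫ x in U, ⟪V x, y⟫ * φ x

/-- The capacity `Cap_{1,p}(K)`. -/
def cap1p (n : ℕ) (p : ℝ) (K : Set (Euc n)) : ℝ :=
  sInf {c : ℝ | ∃ φ : Euc n → ℝ, ContDiff ℝ (⊤ : ℕ∞) φ ∧ HasCompactSupport φ ∧
    (∀ x, 0 ≤ φ x ∧ φ x ≤ 1) ∧ (∀ x ∈ K, 1 ≤ φ x) ∧
    c = ∫ x, (‖gradient φ x‖ ^ p + φ x ^ p)}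

/-- Membership in the space `M^{1,p}(Ω)` of Sobolev multipliers. -/
def MemM1p (n : ℕ) (p : ℝ) (Ω : Set (Euc n)) (f : Euc n → ℝ) : Prop :=
  MemLp f (ENNReal.ofReal p) (volume.restrict Ω) ∧
  ∃ C : ℝ, 0 ≤ C ∧ ∀ K : Set (Euc n), K ⊆ Ω → IsCompact K →
    ∫ x in K, |f x| ^ p ≤ C * cap1p n p K

/-- The norm in `M^{1,p}(Ω)`: the `p`-th root of the least admissible constant. -/
def M1pNorm (n : ℕ) (p : ℝ) (Ω : Set (Euc n)) (f : Euc n → ℝ) : ℝ :=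
  sInf {C : ℝ | 0 ≤ C ∧ ∀ K : Set (Euc n), K ⊆ Ω → IsCompact K →
    ∫ x in K, |f x| ^ p ≤ C * cap1p n p K} ^ (1/p)

/-- `u ∈ W^{1,p}_0(Ω)` with weak gradient `V`. -/
def MemW1p0 (n : ℕ) (p : ℝ) (Ω : Set (Euc n)) (u : Euc n → ℝ) (V : Euc n → Euc n) : Prop :=
  (∀ᵐ x : Euc n, x ∉ Ω → u x = 0) ∧
  MemLp u (ENNReal.ofReal p) volume ∧
  MemLp (fun x => ‖V x‖) (ENNReal.ofReal p) volume ∧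
  IsWeakGrad n Set.univ u V ∧
  ∃ φ : ℕ → Euc n → ℝ, (∀ j, IsTest n Ω (φ j)) ∧
    Tendsto (fun j => (∫ x, |φ j x - u x| ^ p) ^ (1/p)
      + (∫ x, ‖gradient (φ j) x - V x‖ ^ p) ^ (1/p)) atTop (nhds 0)

lemma aux_norm_grad {n : ℕ} (φ : Euc n → ℝ) (x : Euc n) : ‖gradient φ x‖ = ‖fderiv ℝ φ x‖ := by
  simp [gradient]

lemma aux_int_grad {n : ℕ} {p : ℝ} (hp : 1 < p) {φ : Euc n → ℝ} (h1 : ContDiff ℝ (⊤ : ℕ∞) φ)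
    (h2 : HasCompactSupport φ) : Integrable (fun x => ‖gradient φ x‖ ^ p) := by
  simp_rw [aux_norm_grad]
  apply Continuous.integrable_of_hasCompactSupport
  · exact ((h1.continuous_fderiv (by simp)).norm).rpow_const (fun x => Or.inr (by linarith))
  · exact (h2.fderiv ℝ).comp_left (g := fun y => ‖y‖ ^ p)
      (by simp [Real.zero_rpow (by linarith : p ≠ 0)])

lemma aux_int_abs {n : ℕ} {p : ℝ} (hp : 1 < p) {φ : Euc n → ℝ} (h1 : ContDiff ℝ (⊤ : ℕ∞) φ)
    (h2 : HasCompactSupport φ) : Integrable (fun x => |φ x| ^ p) := by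
  apply Continuous.integrable_of_hasCompactSupport
  · exact (h1.continuous.abs).rpow_const (fun x => Or.inr (by linarith))
  · exact h2.comp_left (g := fun y => |y| ^ p)
      (by simp [Real.zero_rpow (by linarith : p ≠ 0)])

lemma aux_poincare {n : ℕ} (hn : 2 ≤ n) {p : ℝ} (hp : 1 < p) {R : ℝ} (hR : 0 ≤ R)
    {φ : Euc n → ℝ} (h1 : ContDiff ℝ (⊤ : ℕ∞) φ)
    (h2 : HasCompactSupport φ) (h3 : ∀ x ∈ tsupport φ, ‖x‖ ≤ R) :
    ∫ x, |φ x| ^ p ≤ (p * R) ^ p * ∫ x, ‖gradient φ x‖ ^ p := by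
  have hp0 : p ≠ 0 := by linarith
  let i : Fin n := ⟨0, by omega⟩
  let f : Euc n →L[ℝ] ℝ := EuclideanSpace.proj i
  let e : Euc n := EuclideanSpace.single i 1
  have hfe : f e = 1 := by simp [f, e]
  have hne : ‖e‖ = 1 := by simp [e]
  have hfx : ∀ x, |f x| ≤ ‖x‖ := fun x => by
    simpa [f] using PiLp.norm_apply_le x i
  let G : Euc n → ℝ := fun x => ‖φ x‖ ^ p
  have hφd : Differentiable ℝ φ := h1.differentiable (by simp)
  have hG : ContDiff ℝ 1 G := (h1.of_le (by exact_mod_cast le_top)).norm_rpow hp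
  have hGs : HasCompactSupport G := h2.comp_left (g := fun y => ‖y‖ ^ p)
      (by simp [Real.zero_rpow hp0])
  have hGi : Integrable G := hG.continuous.integrable_of_hasCompactSupport hGs
  have hGc : Continuous (fun x => fderiv ℝ G x e) :=
    (hG.continuous_fderiv (by simp)).clm_apply continuous_const
  have hI : Integrable (fun x => f x * fderiv ℝ G x e) := by
    apply (f.continuous.mul hGc).integrable_of_hasCompactSupport
    have h0 : HasCompactSupport (fun x => fderiv ℝ G x e) := hGs.fderiv_apply ℝ e
    exact HasCompactSupport.mul_left (f := fun x => f x) h0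
  have key := integral_mul_fderiv_eq_neg_fderiv_mul_of_integrable (μ := volume)
    (f := fun x => f x) (g := G) (v := e)
    (by simpa [hfe] using hGi) hI
    ((f.continuous.mul hG.continuous).integrable_of_hasCompactSupport hGs.mul_left)
    (fun x _ => f.differentiableAt) (fun x _ => hG.differentiable (by simp) x)
  simp only [ContinuousLinearMap.fderiv, hfe, one_mul] at key
  set q := p / (p - 1) with hq
  have hpq : q.HolderConjugate p := (Real.HolderConjugate.conjExponent hp).symm
  have hpt : ∀ x, -(f x * fderiv ℝ G x e) ≤
      (1 - 1/p) * |φ x| ^ p + (1/p) * ((p * R) ^ p * ‖gradient φ x‖ ^ p) := by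
    intro x
    have a1 : -(f x * fderiv ℝ G x e) ≤ |φ x| ^ (p-1) * (p * R * ‖gradient φ x‖) := by
      have b1 : |fderiv ℝ G x e| ≤ p * |φ x| ^ (p - 1) * ‖gradient φ x‖ := by
        have c1 := (fderiv ℝ G x).le_opNorm e
        have c2 := norm_fderiv_norm_rpow_le hφd (x := x) hp
        rw [hne, mul_one] at c1
        rw [aux_norm_grad]
        exact c1.trans c2
      have b2 : |f x| * |φ x| ^ (p-1) ≤ R * |φ x| ^ (p-1) := by
        by_cases hx : x ∈ tsupport φ
        · exact mul_le_mul_of_nonneg_right ((hfx x).trans (h3 x hx)) (by positivity)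
        · rw [image_eq_zero_of_notMem_tsupport hx]
          simp [Real.zero_rpow (by linarith : p - 1 ≠ 0)]
      calc -(f x * fderiv ℝ G x e) ≤ |f x * fderiv ℝ G x e| := neg_le_abs _
        _ = |f x| * |fderiv ℝ G x e| := abs_mul _ _
        _ ≤ |f x| * (p * |φ x| ^ (p - 1) * ‖gradient φ x‖) := by gcongr
        _ = (|f x| * |φ x| ^ (p - 1)) * (p * ‖gradient φ x‖) := by ring
        _ ≤ (R * |φ x| ^ (p - 1)) * (p * ‖gradient φ x‖) := by gcongr
        _ = _ := by ring
    have a2 := Real.young_inequality_of_nonneg (a := |φ x| ^ (p-1)) (b := p * R * ‖gradient φ x‖)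
      (by positivity) (by positivity) hpq
    rw [← Real.rpow_mul (abs_nonneg _), Real.mul_rpow (by positivity) (norm_nonneg _),
      show (p - 1) * q = p by rw [hq]; field_simp [(by linarith : p - 1 ≠ 0)]] at a2
    have a3 : 1 - 1/p = 1/q := by rw [hq]; field_simp
    rw [a3]
    refine a1.trans (a2.trans (le_of_eq ?_))
    ring
  have iA := aux_int_abs hp h1 h2
  have iB := aux_int_grad hp h1 h2
  have hint := integral_mono hI.neg ((iA.const_mul (1 - 1/p)).add
    ((iB.const_mul ((p*R)^p)).const_mul (1/p))) hpt
  simp only [Pi.neg_apply, Pi.add_apply] at hint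
  rw [integral_neg, key, neg_neg, integral_add (iA.const_mul _) ((iB.const_mul _).const_mul _),
    integral_const_mul, integral_const_mul, integral_const_mul] at hint
  have hGe : ∫ x, G x = ∫ x, |φ x| ^ p := rfl
  rw [hGe] at hint
  have h5 : (1/p) * ∫ x, |φ x| ^ p ≤ (1/p) * ((p * R) ^ p * ∫ x, ‖gradient φ x‖ ^ p) := by linarith
  exact le_of_mul_le_mul_left h5 (by positivity)

lemma aux_setint {n : ℕ} {p : ℝ} (hp : 1 < p) {U : Set (Euc n)} {φ : Euc n → ℝ}
    (h : tsupport φ ⊆ U) : ∫ x in U, ‖gradient φ x‖ ^ p = ∫ x, ‖gradient φ x‖ ^ p := by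
  apply setIntegral_eq_integral_of_forall_compl_eq_zero
  intro x hx
  have : fderiv ℝ φ x = 0 := by
    by_contra h0
    exact hx (h (support_fderiv_subset ℝ h0))
  rw [aux_norm_grad, this]
  simp [Real.zero_rpow (by linarith : p ≠ 0)]

lemma aux_cutoff {n : ℕ} {Ω Ωt : Set (Euc n)} (hΩto : IsOpen Ωt) (hΩtb : Bornology.IsBounded Ωt)
    (hsub : closure Ω ⊆ Ωt) : ∃ η : Euc n → ℝ, ContDiff ℝ (⊤ : ℕ∞) η ∧ HasCompactSupport η ∧
      tsupport η ⊆ Ωt ∧ (∀ x ∈ Ω, η x = 1) ∧ ∀ x, |η x| ≤ 1 := by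
  obtain ⟨f, hf0, hf1, hf⟩ := exists_contMDiffMap_zero_one_nhds_of_isClosed
    (modelWithCornersSelf ℝ (Euc n)) (n := (⊤ : ℕ∞)) hΩto.isClosed_compl
    (isClosed_closure (s := Ω)) (Set.disjoint_compl_left_iff_subset.2 hsub)
  have hts : tsupport f ⊆ Ωt := by
    intro x hx
    by_contra hx'
    have := hf0.filter_mono (nhds_le_nhdsSet (show x ∈ Ωtᶜ from hx'))
    exact (notMem_tsupport_iff_eventuallyEq.2 this) hx
  refine ⟨f, f.contMDiff.contDiff, ?_, hts, ?_, ?_⟩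
  · exact Metric.isCompact_of_isClosed_isBounded (isClosed_tsupport _) (hΩtb.subset hts)
  · exact fun x hx => hf1.self_of_nhdsSet x (subset_closure hx)
  · exact fun x => abs_le.2 ⟨by linarith [(hf x).1], (hf x).2⟩

/-- for `g` supported in `Ω ⋐ Ω̃`, the inhomogeneous multiplier
inequality over `ℝⁿ` is equivalent to the homogeneous one over `Ω̃`. -/
theorem statement10 (n : ℕ) (hn : 2 ≤ n) (p : ℝ) (hp : 1 < p)
    (Ω Ωt : Set (Euc n)) (hΩo : IsOpen Ω) (hΩb : Bornology.IsBounded Ω)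
    (hΩto : IsOpen Ωt) (hΩtb : Bornology.IsBounded Ωt)
    (hsub : closure Ω ⊆ Ωt)
    (g : Euc n → ℝ) (hgm : Measurable g) (hg0 : ∀ x, 0 ≤ g x)
    (hgz : ∀ᵐ x : Euc n, x ∉ Ω → g x = 0) :
    (∃ lam : ℝ, 0 < lam ∧
      ∀ φ : Euc n → ℝ, ContDiff ℝ (⊤ : ℕ∞) φ → HasCompactSupport φ →
        ∫ x in Ω, g x * |φ x| ^ p
          ≤ lam * ∫ x, (‖gradient φ x‖ ^ p + |φ x| ^ p)) ↔
    (∃ lam' : ℝ, 0 < lam' ∧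
      ∀ φ : Euc n → ℝ, IsTest n Ωt φ →
        ∫ x in Ω, g x * |φ x| ^ p ≤ lam' * ∫ x in Ωt, ‖gradient φ x‖ ^ p) := by
  constructor
  · rintro ⟨lam, hlam, H⟩
    obtain ⟨R, hR⟩ := hΩtb.subset_closedBall (0 : Euc n)
    have hpos : 0 ≤ (p * max R 0) ^ p := by positivity
    refine ⟨lam * (1 + (p * max R 0) ^ p), by positivity, fun φ hφ => ?_⟩
    obtain ⟨h1, h2, h3⟩ := hφ
    have hP := aux_poincare hn hp (le_max_right R 0) h1 h2 (fun x hx => by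
      have := hR (h3 hx)
      rw [mem_closedBall_zero_iff] at this
      exact this.trans (le_max_left _ _))
    have := H φ h1 h2
    rw [integral_add (aux_int_grad hp h1 h2) (aux_int_abs hp h1 h2)] at this
    rw [aux_setint hp h3]
    refine this.trans ?_
    rw [mul_assoc]
    gcongr
    linarith
  · rintro ⟨lam, hlam, H⟩
    obtain ⟨η, e1, e2, e3, e4, e5⟩ := aux_cutoff hΩto hΩtb hsub
    obtain ⟨M, hM⟩ := (e2.fderiv ℝ).exists_bound_of_continuous (e1.continuous_fderiv (by simp))
    have hM0 : 0 ≤ M := (norm_nonneg _).trans (hM 0)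
    refine ⟨lam * (1 + M) ^ p * 2 ^ (p-1), by positivity, fun φ h1 h2 => ?_⟩
    have t1 : ContDiff ℝ (⊤ : ℕ∞) (fun x => φ x * η x) := h1.mul e1
    have t2 : HasCompactSupport (fun x => φ x * η x) := h2.mul_right
    have t3 : tsupport (fun x => φ x * η x) ⊆ Ωt := (tsupport_mul_subset_right).trans e3
    have hT := H _ ⟨t1, t2, t3⟩
    rw [aux_setint hp t3] at hT
    have hL : ∫ x in Ω, g x * |φ x * η x| ^ p = ∫ x in Ω, g x * |φ x| ^ p :=
      setIntegral_congr_fun hΩo.measurableSet (fun x hx => by simp [e4 x hx])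
    rw [hL] at hT
    refine hT.trans ?_
    rw [mul_assoc, mul_assoc]
    refine mul_le_mul_of_nonneg_left ?_ hlam.le
    rw [← integral_const_mul, ← integral_const_mul]
    refine integral_mono (aux_int_grad hp t1 t2)
      ((((aux_int_grad hp h1 h2).add (aux_int_abs hp h1 h2)).const_mul _).const_mul _) ?_
    intro x
    have b1 : ‖gradient (fun x => φ x * η x) x‖ ≤ (1 + M) * (‖gradient φ x‖ + |φ x|) := by
      rw [aux_norm_grad, aux_norm_grad, fderiv_fun_mul (h1.differentiable (by simp) x)
        (e1.differentiable (by simp) x)]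
      refine (norm_add_le _ _).trans ?_
      rw [norm_smul, norm_smul, Real.norm_eq_abs, Real.norm_eq_abs]
      have c1 : |φ x| * ‖fderiv ℝ η x‖ ≤ |φ x| * M := by gcongr; exact hM x
      have c2 : |η x| * ‖fderiv ℝ φ x‖ ≤ 1 * ‖fderiv ℝ φ x‖ := by gcongr; exact e5 x
      have c3 : 0 ≤ M * ‖fderiv ℝ φ x‖ := by positivity
      nlinarith [abs_nonneg (φ x)]
    have b2 : (‖gradient φ x‖ + |φ x|) ^ p ≤ 2 ^ (p-1) * (‖gradient φ x‖ ^ p + |φ x| ^ p) := by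
      have := NNReal.rpow_add_le_mul_rpow_add_rpow ‖gradient φ x‖₊ ‖φ x‖₊ hp.le
      exact_mod_cast this
    calc ‖gradient (fun x => φ x * η x) x‖ ^ p
        ≤ ((1 + M) * (‖gradient φ x‖ + |φ x|)) ^ p := by gcongr
      _ = (1 + M) ^ p * (‖gradient φ x‖ + |φ x|) ^ p := Real.mul_rpow (by positivity) (by positivity)
      _ ≤ (1 + M) ^ p * (2 ^ (p-1) * (‖gradient φ x‖ ^ p + |φ x| ^ p)) := by gcongr

end
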